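/- arXiv:1409.8125 — 2 statements merged into one kernel-verified Lean document; each statement's English description precedes it below -/
import Mathlib

section
/- (Lemma 1 of the paper.) Let M ≥ 5 be prime and let 1 ≤ ñ ≤ ⌊M/2⌋. Let S₁ and S₂ be two subsets of {0,…,M−1} × {0,…,M−1}, each of cardinality ñ, such that within each set the first coordinates (the shift indices k) are pairwise distinct. If S₁ ≠ S₂, then the linear subspaces of ℂ^M spanned by the corresponding Gabor vectors are distinct: span{g_{k,l} : (k,l) ∈ S₁} ≠ span{g_{k,l} : (k,l) ∈ S₂}. That is, distinct effective codewords formed from ñ ≤ ⌊M/2⌋ active users correspond to distinct subspaces, so up to ⌊M/2⌋ users can be resolved without ambiguity in the absence of noise. -/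
open scoped BigOperators

/-- The Gabor frame vector `g_{k,l} ∈ ℂ^M`, with
`g_{k,l}(m) = exp(2πi·((m−k)³ + l·m)/M)`. -/
noncomputable def gabor (M : ℕ) (k l : Fin M) : Fin M → ℂ :=
  fun m => Complex.exp (2 * Real.pi * Complex.I *
    ((((m : ℕ) : ℂ) - ((k : ℕ) : ℂ)) ^ 3 + ((l : ℕ) : ℂ) * ((m : ℕ) : ℂ)) / (M : ℂ))

/-- The inner product `⟨u,v⟩ = ∑_{m} u(m)·conj(v(m))` on `ℂ^M`. -/
noncomputable def gip (M : ℕ) (u v : Fin M → ℂ) : ℂ :=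
  ∑ m : Fin M, u m * (starRingEnd ℂ) (v m)

theorem one_add_pow_eq_sum_range_add {R : Type*} [CommRing R] (y : R) (n k : ℕ) :
    ∃ r : R, (1 + y) ^ n = ∑ j ∈ Finset.range k, (n.choose j : R) * y ^ j + y ^ k * r := by
  refine ⟨∑ j ∈ Finset.range (n + 1), (n.choose (k + j) : R) * y ^ j, ?_⟩
  have h : ∑ j ∈ Finset.range (n + 1 + k), (n.choose j : R) * y ^ j = (1 + y) ^ n := by
    rw [Finset.sum_range_add, add_comm 1 y, add_pow, Finset.sum_eq_zero (s := Finset.range k), add_zero]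
    · exact Finset.sum_congr rfl fun j _ => by rw [one_pow, mul_one, mul_comm]
    · intro j _
      rw [Nat.choose_eq_zero_of_lt (by lia), Nat.cast_zero, zero_mul]
  rw [← h, add_comm (n + 1) k, Finset.sum_range_add, Finset.mul_sum]
  congr 1
  exact Finset.sum_congr rfl fun j _ => by ring

theorem exists_weighted_sum_one_add_pow {R : Type*} [CommRing R] (y : R) (s : Finset ℕ)
    (w : ℕ → ℤ) (q : ℕ → ℕ) (k : ℕ) (h : ∀ j < k, ∑ m ∈ s, w m * ((q m).choose j : ℤ) = 0) :
    ∃ r : R, ∑ m ∈ s, (w m : R) * (1 + y) ^ q m =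
      y ^ k * (((∑ m ∈ s, w m * ((q m).choose k : ℤ) : ℤ) : R) + y * r) := by
  choose r hr using fun m => one_add_pow_eq_sum_range_add y (q m) (k + 1)
  refine ⟨∑ m ∈ s, (w m : R) * r m, ?_⟩
  have h' : ∀ j < k, ∑ m ∈ s, (w m : R) * ((q m).choose j : R) = 0 := fun j hj => by
    exact_mod_cast congrArg (Int.cast : ℤ → R) (h j hj)
  calc ∑ m ∈ s, (w m : R) * (1 + y) ^ q m
      = ∑ m ∈ s, ∑ j ∈ Finset.range (k + 1), (w m : R) * ((q m).choose j : R) * y ^ j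
        + ∑ m ∈ s, y ^ (k + 1) * ((w m : R) * r m) := by
        rw [← Finset.sum_add_distrib]
        refine Finset.sum_congr rfl fun m _ => ?_
        rw [hr, mul_add, Finset.mul_sum]
        simp only [mul_assoc, mul_left_comm]
    _ = _ := by
        rw [Finset.sum_comm, ← Finset.mul_sum]
        simp_rw [← Finset.sum_mul]
        rw [Finset.sum_range_succ, Finset.sum_eq_zero
          (fun j hj => by rw [h' j (Finset.mem_range.mp hj), zero_mul])]
        push_cast
        ring

/-- The signed binomial weights computing the `n`-th forward difference at `0`. -/
def fwdDiffWeight (n m : ℕ) : ℤ := (-1) ^ (n - m) * n.choose m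

open Polynomial in
theorem sum_fwdDiffWeight_mul_eval (P : ℤ[X]) (n : ℕ) (hP : P.natDegree ≤ n) :
    ∑ m ∈ Finset.range (n + 1), fwdDiffWeight n m * P.eval (m : ℤ) =
      P.coeff n * (n.factorial : ℤ) := by
  have h := fwdDiff_iter_eq_sum_shift (1 : ℤ) (fun x => P.eval x) n 0
  simp only [nsmul_eq_mul, mul_one, zero_add, smul_eq_mul] at h
  unfold fwdDiffWeight
  rw [← h]
  rcases hP.lt_or_eq with hlt | rfl
  · rw [P.fwdDiff_iter_eq_zero_of_degree_lt hlt, coeff_eq_zero_of_natDegree_lt hlt]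
    simp
  · rw [P.fwdDiff_iter_degree_eq_factorial]
    simp

open Polynomial in
theorem sum_fwdDiffWeight_mul_choose_quadratic (a b j n : ℕ) (ha : 0 < a) (hj : 2 * j ≤ n) :
    (j.factorial : ℤ) * ∑ m ∈ Finset.range (n + 1),
      fwdDiffWeight n m * ((a * m ^ 2 + b * m).choose j : ℤ) =
      (if 2 * j = n then (a : ℤ) ^ j else 0) * (n.factorial : ℤ) := by
  set Q : ℤ[X] := C (a : ℤ) * X ^ 2 + C (b : ℤ) * X + C 0 with hQ
  have ha' : (a : ℤ) ≠ 0 := by exact_mod_cast ha.ne'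
  have hdQ : Q.natDegree = 2 := natDegree_quadratic ha'
  have hlQ : Q.leadingCoeff = a := leadingCoeff_quadratic ha'
  have hd : ((descPochhammer ℤ j).comp Q).natDegree = 2 * j := by
    rw [natDegree_comp, descPochhammer_natDegree, hdQ, mul_comm]
  have hc : ((descPochhammer ℤ j).comp Q).coeff n = if 2 * j = n then (a : ℤ) ^ j else 0 := by
    split_ifs with h
    · rw [← h, ← hd, coeff_natDegree, leadingCoeff_comp (by rw [hdQ]; decide), hlQ,
        (monic_descPochhammer ℤ j).leadingCoeff, one_mul, descPochhammer_natDegree]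
    · exact coeff_eq_zero_of_natDegree_lt (by rw [hd]; lia)
  rw [← hc, ← sum_fwdDiffWeight_mul_eval _ n (hd.trans_le hj), Finset.mul_sum]
  refine Finset.sum_congr rfl fun m _ => ?_
  have he : Q.eval (m : ℤ) = ((a * m ^ 2 + b * m : ℕ) : ℤ) := by simp [hQ]
  rw [eval_comp, he, descPochhammer_eval_eq_descFactorial, Nat.descFactorial_eq_factorial_mul_choose]
  push_cast
  ring

theorem exists_fwdDiff_pow_quadratic {R : Type*} [CommRing R] (ω : R) (a b k : ℕ) (ha : 0 < a) :
    ∃ (z : ℤ) (r : R), (k.factorial : ℤ) * z = (a : ℤ) ^ k * ((2 * k).factorial : ℤ) ∧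
      ∑ m ∈ Finset.range (2 * k + 1), (fwdDiffWeight (2 * k) m : R) * ω ^ (a * m ^ 2 + b * m) =
      (ω - 1) ^ k * ((z : R) + (ω - 1) * r) := by
  obtain ⟨r, hr⟩ := exists_weighted_sum_one_add_pow (ω - 1) (Finset.range (2 * k + 1))
    (fwdDiffWeight (2 * k)) (fun m => a * m ^ 2 + b * m) k (fun j hj => by
      have h := sum_fwdDiffWeight_mul_choose_quadratic a b j (2 * k) ha (by lia)
      rw [if_neg (by lia), zero_mul] at h
      exact (mul_eq_zero.mp h).resolve_left (by exact_mod_cast j.factorial_ne_zero))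
  refine ⟨_, r, ?_, by simpa only [add_sub_cancel] using hr⟩
  rw [sum_fwdDiffWeight_mul_choose_quadratic a b k (2 * k) ha le_rfl, if_pos rfl]

/-- Even moments of the reduced coefficients of a relation between quadratic chirps. -/
theorem sum_map_mul_pow_eq_zero_of_relation {R F ι : Type*} [CommRing R] [IsDomain R] [Field F]
    (p : ℕ) [hp : Fact p.Prime] [CharP F p] (φ : R →+* F) (ω : R) (hω : ω ≠ 1) (hφ : φ ω = 1)
    (s : Finset ι) (c : ι → R) (a b : ι → ℕ) (ha : ∀ i, 0 < a i)
    (h : ∀ m : ℕ, ∑ i ∈ s, c i * ω ^ (a i * m ^ 2 + b i * m) = 0) (k : ℕ) (hk : 2 * k < p) :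
    ∑ i ∈ s, φ (c i) * (a i : F) ^ k = 0 := by
  choose z r hz hr using fun i => exists_fwdDiff_pow_quadratic ω (a i) (b i) k (ha i)
  have hsum : (ω - 1) ^ k * ∑ i ∈ s, c i * ((z i : R) + (ω - 1) * r i) = 0 := by
    calc _ = ∑ i ∈ s, c i * ∑ m ∈ Finset.range (2 * k + 1),
          (fwdDiffWeight (2 * k) m : R) * ω ^ (a i * m ^ 2 + b i * m) := by
          rw [Finset.mul_sum]
          exact Finset.sum_congr rfl fun i _ => by rw [hr]; ring
      _ = ∑ m ∈ Finset.range (2 * k + 1), (fwdDiffWeight (2 * k) m : R) *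
          ∑ i ∈ s, c i * ω ^ (a i * m ^ 2 + b i * m) := by
          simp_rw [Finset.mul_sum]
          rw [Finset.sum_comm]
          exact Finset.sum_congr rfl fun m _ => Finset.sum_congr rfl fun i _ => by ring
      _ = 0 := by simp [h]
  have h1 := congrArg φ ((mul_eq_zero.mp hsum).resolve_left (pow_ne_zero _ (sub_ne_zero.mpr hω)))
  simp only [map_sum, map_mul, map_add, map_sub, hφ, map_one, sub_self, zero_mul, add_zero,
    map_intCast, map_zero] at h1
  have hfac : (((2 * k).factorial : ℕ) : F) ≠ 0 := by
    rw [Ne, CharP.cast_eq_zero_iff F p, hp.out.dvd_factorial]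
    lia
  refine (mul_eq_zero.mp ?_).resolve_left hfac
  have hz' : ∀ i, (k.factorial : F) * (z i : F) = (a i : F) ^ k * ((2 * k).factorial : F) :=
    fun i => by exact_mod_cast congrArg (Int.cast : ℤ → F) (hz i)
  calc _ = (k.factorial : F) * ∑ i ∈ s, φ (c i) * (z i : F) := by
        simp_rw [Finset.mul_sum]
        exact Finset.sum_congr rfl fun i _ => by linear_combination -φ (c i) * hz' i
    _ = 0 := by rw [h1, mul_zero]

theorem sum_map_mul_linear_eq_zero_of_relation {R F ι : Type*} [CommRing R] [IsDomain R] [Field F]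
    (p : ℕ) [hp : Fact p.Prime] [CharP F p] (hp2 : 2 < p) (φ : R →+* F) (ω : R) (hω : ω ≠ 1)
    (hφ : φ ω = 1) (s : Finset ι) (c : ι → R) (a b : ι → ℕ) (ha : ∀ i, 0 < a i)
    (h : ∀ m : ℕ, ∑ i ∈ s, c i * ω ^ (a i * m ^ 2 + b i * m) = 0) :
    ∑ i ∈ s, φ (c i) * (b i : F) = 0 := by
  have h0 : ∑ i ∈ s, φ (c i) * (a i : F) = 0 := by
    simpa using sum_map_mul_pow_eq_zero_of_relation p φ ω hω hφ s c a b ha h 1 (by lia)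
  have hgeom : ∀ n : ℕ, ω ^ n - 1 = (ω - 1) * ∑ j ∈ Finset.range n, ω ^ j :=
    fun n => (mul_geom_sum ω n).symm
  have hsum : (ω - 1) * ∑ i ∈ s, c i * ∑ j ∈ Finset.range (a i + b i), ω ^ j = 0 := by
    have h1 := h 1
    have h2 := h 0
    simp only [one_pow, mul_one, ne_eq, OfNat.ofNat_ne_zero, not_false_eq_true, zero_pow, mul_zero,
      add_zero, pow_zero] at h1 h2
    rw [Finset.mul_sum, ← sub_zero (0 : R)]
    nth_rw 1 [← h1]
    rw [← h2, ← Finset.sum_sub_distrib]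
    exact Finset.sum_congr rfl fun i _ => by linear_combination -c i * hgeom (a i + b i)
  have h1 := congrArg φ ((mul_eq_zero.mp hsum).resolve_left (sub_ne_zero.mpr hω))
  simp only [map_sum, map_mul, map_pow, hφ, one_pow, Finset.sum_const, Finset.card_range,
    nsmul_eq_mul, mul_one, Nat.cast_add, mul_add, Finset.sum_add_distrib, map_zero] at h1
  rwa [h0, zero_add] at h1

theorem ValuationSubring.exists_natCast_mem_nonunits (K : Type*) [Field K] [CharZero K] {p : ℕ}
    (hp : p.Prime) : ∃ B : ValuationSubring K, (p : K) ∈ B.nonunits := by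
  let f : ℤ ≃+* (Int.castRingHom K).range :=
    RingEquiv.ofBijective (Int.castRingHom K).rangeRestrict
      ⟨fun x y h => Int.cast_injective (α := K) (congrArg Subtype.val h),
        (Int.castRingHom K).rangeRestrict_surjective⟩
  have hI : Ideal.span {f (p : ℤ)} ≠ ⊤ := by
    rw [Ne, Ideal.span_singleton_eq_top, MulEquiv.isUnit_map]
    exact (Nat.prime_iff_prime_int.mp hp).not_isUnit
  obtain ⟨B, -, hB⟩ := Ideal.image_subset_nonunits_valuationSubring _ hI
  refine ⟨B, hB ⟨f (p : ℤ), Ideal.mem_span_singleton_self _, ?_⟩⟩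
  exact map_natCast (Int.castRingHom K) p

theorem Finset.sum_filter_eq_zero_of_power_sums {ι F : Type*} [Field F] [DecidableEq F]
    (s : Finset ι) (e x : ι → F) (h : ∀ k < (s.image x).card, ∑ i ∈ s, e i * x i ^ k = 0) {i : ι}
    (hi : i ∈ s) : ∑ j ∈ s with x j = x i, e j = 0 := by
  set P : Polynomial F := ∏ y ∈ (s.image x).erase (x i), (Polynomial.X - Polynomial.C y) with hP
  have hmem : x i ∈ s.image x := Finset.mem_image_of_mem x hi
  have hdeg : P.natDegree < (s.image x).card := by
    rw [hP, Polynomial.natDegree_finsetProd_X_sub_C_eq_card (f := fun y => y)]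
    exact Finset.card_erase_lt_of_mem hmem
  have hsum : ∑ j ∈ s, e j * P.eval (x j) = 0 := by
    simp_rw [Polynomial.eval_eq_sum_range' hdeg, Finset.mul_sum]
    rw [Finset.sum_comm]
    refine Finset.sum_eq_zero fun k hk => ?_
    rw [← mul_zero (P.coeff k), ← h k (Finset.mem_range.mp hk), Finset.mul_sum]
    exact Finset.sum_congr rfl fun j _ => by ring
  have hne : P.eval (x i) ≠ 0 := by
    rw [hP, Polynomial.eval_prod, Finset.prod_ne_zero_iff]
    intro y hy
    simpa [sub_eq_zero] using (Finset.ne_of_mem_erase hy).symm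
  refine (mul_eq_zero.mp ?_).resolve_right hne
  rw [← hsum, Finset.sum_filter, Finset.sum_mul]
  refine Finset.sum_congr rfl fun j hj => ?_
  split_ifs with hji
  · rw [hji]
  · have h0 : P.eval (x j) = 0 := by
      rw [hP, Polynomial.eval_prod]
      exact Finset.prod_eq_zero
        (Finset.mem_erase.mpr ⟨hji, Finset.mem_image_of_mem x hj⟩) (by simp)
    rw [h0, zero_mul, mul_zero]

/-- A relation with power-sum moments and one linear moment is trivial when all nodes but one are
distinct. -/
theorem Finset.eq_zero_of_power_sums_insert {ι F : Type*} [DecidableEq ι] [Field F] (s : Finset ι)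
    (i₀ : ι) (hi₀ : i₀ ∉ s) (e x y : ι → F) (hx : Set.InjOn x s)
    (hy : ∀ j ∈ s, x j = x i₀ → y j ≠ y i₀)
    (h : ∀ k ≤ s.card, ∑ i ∈ insert i₀ s, e i * x i ^ k = 0)
    (hlin : ∑ i ∈ insert i₀ s, e i * y i = 0) : ∀ i ∈ insert i₀ s, e i = 0 := by
  classical
  have hcard : ((insert i₀ s).image x).card ≤ s.card + 1 :=
    Finset.card_image_le.trans (Finset.card_insert_le _ _)
  have hfib : ∀ i ∈ insert i₀ s, ∑ j ∈ insert i₀ s with x j = x i, e j = 0 := fun i hi =>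
    Finset.sum_filter_eq_zero_of_power_sums _ e x (fun k hk => h k (by lia)) hi
  have hfar : ∀ i ∈ s, x i ≠ x i₀ → e i = 0 := by
    intro i hi hne
    have hs : {j ∈ insert i₀ s | x j = x i} = {i} := by
      ext j
      simp only [Finset.mem_filter, Finset.mem_insert, Finset.mem_singleton]
      constructor
      · rintro ⟨rfl | hj, hji⟩
        · exact absurd hji.symm hne
        · exact hx hj hi hji
      · rintro rfl
        exact ⟨Or.inr hi, rfl⟩
    simpa [hs] using hfib i (Finset.mem_insert_of_mem hi)
  by_cases hq : ∃ q ∈ s, x q = x i₀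
  · obtain ⟨q, hqs, hqx⟩ := hq
    have hz : ∀ i ∈ s, i ≠ q → e i = 0 := fun i hi hiq =>
      hfar i hi fun hix => hiq (hx hi hqs (hix.trans hqx.symm))
    have h0 := h 0 (Nat.zero_le _)
    simp only [pow_zero, mul_one] at h0
    rw [Finset.sum_insert hi₀, Finset.sum_eq_single_of_mem q hqs hz] at h0
    rw [Finset.sum_insert hi₀, Finset.sum_eq_single_of_mem q hqs
      (fun i hi hiq => by rw [hz i hi hiq, zero_mul])] at hlin
    have heq : e q * (y q - y i₀) = 0 := by linear_combination hlin - y i₀ * h0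
    have hq0 : e q = 0 := (mul_eq_zero.mp heq).resolve_right (sub_ne_zero.mpr (hy q hqs hqx))
    intro i hi
    rcases Finset.mem_insert.mp hi with rfl | hi
    · simpa [hq0] using h0
    · by_cases hiq : i = q
      · rw [hiq, hq0]
      · exact hz i hi hiq
  · push Not at hq
    have hz : ∀ i ∈ s, e i = 0 := fun i hi => hfar i hi (hq i hi)
    intro i hi
    rcases Finset.mem_insert.mp hi with rfl | hi
    · have h0 := h 0 (Nat.zero_le _)
      simp only [pow_zero, mul_one] at h0
      rwa [Finset.sum_insert hi₀, Finset.sum_eq_zero hz, add_zero] at h0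
    · exact hz i hi

/-- Quadratic chirps at a `p`-th root of unity satisfy no nontrivial relation when all slopes but
one are distinct modulo `p` and there are at most `(p + 1) / 2` of them. -/
theorem eq_zero_of_sum_mul_pow_quadratic_eq_zero {K ι : Type*} [Field K] [CharZero K]
    [DecidableEq ι] (p : ℕ) [hp : Fact p.Prime] (ω : K) (hω : ω ≠ 1) (hωp : ω ^ p = 1)
    (s : Finset ι) (hs : 2 * s.card < p) (hp2 : 2 < p) (i₀ : ι) (hi₀ : i₀ ∉ s) (a b : ι → ℕ)
    (ha : ∀ i, 0 < a i) (hinj : ∀ i ∈ s, ∀ j ∈ s, a i ≡ a j [MOD p] → i = j)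
    (hb : ∀ j ∈ s, a j ≡ a i₀ [MOD p] → ¬ b j ≡ b i₀ [MOD p]) (c : ι → K)
    (h : ∀ m : ℕ, ∑ i ∈ insert i₀ s, c i * ω ^ (a i * m ^ 2 + b i * m) = 0) :
    ∀ i ∈ insert i₀ s, c i = 0 := by
  obtain ⟨B, hB⟩ := ValuationSubring.exists_natCast_mem_nonunits K hp.out
  let φ : B →+* IsLocalRing.ResidueField B := IsLocalRing.residue B
  have : CharP (IsLocalRing.ResidueField B) p := by
    rw [CharP.charP_iff_prime_eq_zero hp.out]
    obtain ⟨hmem, hmax⟩ := ValuationSubring.mem_nonunits_iff_exists_mem_maximalIdeal.mp hB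
    rw [← map_natCast φ p]
    exact (IsLocalRing.residue_eq_zero_iff _).mpr hmax
  have hωB : ω ∈ B := by
    rw [← B.valuation_le_one_iff]
    refine ((pow_eq_one_iff_of_nonneg zero_le hp.out.ne_zero).mp ?_).le
    rw [← map_pow, hωp, map_one]
  obtain ⟨t, ht, hmax⟩ := Finset.exists_max_image (insert i₀ s) (fun i => B.valuation (c i))
    (Finset.insert_nonempty _ _)
  by_cases hct : c t = 0
  · intro i hi
    have := hmax i hi
    rwa [hct, map_zero, le_zero_iff, map_eq_zero] at this
  exfalso
  have hdiv : ∀ i ∈ insert i₀ s, c i / c t ∈ B := fun i hi => by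
    rw [← B.valuation_le_one_iff, map_div₀]
    exact div_le_one_of_le₀ (hmax i hi) zero_le
  let d : ι → B := fun i => if hi : i ∈ insert i₀ s then ⟨c i / c t, hdiv i hi⟩ else 0
  have hd : ∀ i ∈ insert i₀ s, (d i : K) = c i / c t := fun i hi => by simp only [d, dif_pos hi]
  let w : B := ⟨ω, hωB⟩
  have hw : w ≠ 1 := fun hw => hω (congrArg Subtype.val hw)
  have hwp : w ^ p = 1 := Subtype.ext hωp
  have hφw : φ w = 1 := by
    rw [← sub_eq_zero]
    refine pow_eq_zero_iff hp.out.ne_zero |>.mp ?_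
    rw [sub_pow_char, ← map_pow, hwp, map_one, one_pow, sub_self]
  have hrel : ∀ m : ℕ, ∑ i ∈ insert i₀ s, d i * w ^ (a i * m ^ 2 + b i * m) = 0 := by
    intro m
    apply Subtype.val_injective
    push_cast
    rw [← zero_div (c t), ← h m, Finset.sum_div]
    exact Finset.sum_congr rfl fun i hi => by rw [hd i hi]; ring
  have hcast : ∀ u v : ℕ, (u : IsLocalRing.ResidueField B) = v ↔ u ≡ v [MOD p] :=
    fun u v => CharP.natCast_eq_natCast _ p
  have hzero := Finset.eq_zero_of_power_sums_insert s i₀ hi₀ (fun i => φ (d i))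
    (fun i => (a i : IsLocalRing.ResidueField B)) (fun i => (b i : IsLocalRing.ResidueField B))
    (fun i hi j hj hij => hinj i hi j hj ((hcast _ _).mp hij))
    (fun j hj hij => fun hbj => hb j hj ((hcast _ _).mp hij) ((hcast _ _).mp hbj))
    (fun k hk => sum_map_mul_pow_eq_zero_of_relation p φ w hw hφw _ d a b ha hrel k (by lia))
    (sum_map_mul_linear_eq_zero_of_relation p hp2 φ w hw hφw _ d a b ha hrel) t ht
  have hdt : d t = 1 := Subtype.ext ((hd t ht).trans (div_self hct))
  simp [hdt] at hzero

theorem gabor_eq_mul_pow_quadratic (M : ℕ) (k l m : Fin M) :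
    gabor M k l m = Complex.exp (2 * Real.pi * Complex.I / M) ^ (m : ℕ) ^ 3 *
      (Complex.exp (2 * Real.pi * Complex.I / M) ^ (k : ℕ) ^ 3)⁻¹ *
      Complex.exp (2 * Real.pi * Complex.I / M) ^
        (3 * (M - k : ℕ) * (m : ℕ) ^ 2 + (3 * (k : ℕ) ^ 2 + l) * m) := by
  have hM : M ≠ 0 := k.pos.ne'
  have hMC : (M : ℂ) ≠ 0 := by exact_mod_cast hM
  have h1 : Complex.exp (2 * Real.pi * Complex.I / M) ^ (M * (3 * (m : ℕ) ^ 2)) = 1 := by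
    rw [pow_mul, (Complex.isPrimitiveRoot_exp M hM).pow_eq_one, one_pow]
  rw [mul_right_comm, eq_mul_inv_iff_mul_eq₀ (pow_ne_zero _ (Complex.exp_ne_zero _)),
    ← mul_one (gabor M k l m * _), ← h1, gabor]
  simp only [← Complex.exp_nat_mul, ← Complex.exp_add]
  congr 1
  push_cast [Nat.cast_sub k.isLt.le]
  field_simp
  ring

theorem linearIndepOn_gabor_insert (M : ℕ) (hM : M.Prime) (hM5 : 5 ≤ M)
    (S : Finset (Fin M × Fin M)) (hS : S.card ≤ M / 2)
    (hinj : ∀ p ∈ S, ∀ q ∈ S, p.1 = q.1 → p = q) (p₀ : Fin M × Fin M) (hp₀ : p₀ ∉ S) :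
    LinearIndepOn ℂ (fun p : Fin M × Fin M => gabor M p.1 p.2) (insert p₀ (S : Set _)) := by
  have : Fact M.Prime := ⟨hM⟩
  rw [← Finset.coe_insert, linearIndepOn_finset_iff]
  intro f hf
  set ω := Complex.exp (2 * Real.pi * Complex.I / M) with hωdef
  have hω : IsPrimitiveRoot ω M := Complex.isPrimitiveRoot_exp M hM.ne_zero
  have hω0 : ω ≠ 0 := Complex.exp_ne_zero _
  have hslope : ∀ k k' : Fin M, 3 * (M - k : ℕ) ≡ 3 * (M - k' : ℕ) [MOD M] → k = k' := by
    intro k k' h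
    have hcop : Nat.gcd M 3 = 1 := (Nat.coprime_primes hM Nat.prime_three).mpr (by lia)
    have h1 := Nat.ModEq.cancel_left_of_coprime hcop h
    have h2 := (h1.add_right (k : ℕ)).add_right (k' : ℕ)
    have h3 : (k' : ℕ) ≡ k [MOD M] := by
      rw [show (M - k + k + k' : ℕ) = M + k' by lia,
        show (M - k' + k + k' : ℕ) = M + k by lia] at h2
      exact Nat.ModEq.add_left_cancel' M h2
    exact (Fin.ext (h3.eq_of_lt_of_lt k'.isLt k.isLt)).symm
  have hrel : ∀ m : ℕ, ∑ p ∈ insert p₀ S, (f p * (ω ^ (p.1 : ℕ) ^ 3)⁻¹) *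
      ω ^ (3 * (M - p.1 : ℕ) * m ^ 2 + (3 * (p.1 : ℕ) ^ 2 + p.2) * m) = 0 := by
    intro m
    have h := congrFun hf ⟨m % M, Nat.mod_lt _ hM.pos⟩
    simp only [Finset.sum_apply, Pi.smul_apply, smul_eq_mul, Pi.zero_apply,
      gabor_eq_mul_pow_quadratic, ← hωdef] at h
    refine (mul_eq_zero.mp (Eq.trans ?_ h)).resolve_left (pow_ne_zero ((m % M) ^ 3) hω0)
    rw [Finset.mul_sum]
    refine Finset.sum_congr rfl fun p _ => ?_
    have hmod := Nat.mod_modEq m M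
    rw [pow_eq_pow_of_modEq ((((hmod.pow 2).mul_left (3 * (M - p.1 : ℕ))).add
      (hmod.mul_left (3 * (p.1 : ℕ) ^ 2 + p.2)))) hω.pow_eq_one]
    ring
  intro p hp
  have h0 := eq_zero_of_sum_mul_pow_quadratic_eq_zero M ω (hω.ne_one hM.one_lt) hω.pow_eq_one S
    (by have := hM.eq_two_or_odd; lia) (by lia) p₀ hp₀ (fun p => 3 * (M - p.1 : ℕ))
    (fun p => 3 * (p.1 : ℕ) ^ 2 + p.2) (fun p => by have := p.1.isLt; lia)
    (fun p hp q hq h => hinj p hp q hq (hslope _ _ h))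
    (fun q hq h hb => by
      have hk : q.1 = p₀.1 := hslope _ _ h
      rw [hk] at hb
      have hl := (Nat.ModEq.add_left_cancel' _ hb).eq_of_lt_of_lt q.2.isLt p₀.2.isLt
      exact hp₀ (Prod.ext hk (Fin.ext hl) ▸ hq)) _ hrel p hp
  exact (mul_eq_zero.mp h0).resolve_right (inv_ne_zero (pow_ne_zero _ hω0))

/-- Lemma 1 of the paper: for a prime `M ≥ 5` and `1 ≤ ñ ≤ ⌊M/2⌋`, two distinct
effective codewords — i.e. two distinct sets of `ñ` index pairs, each with pairwise
distinct shift indices — span distinct linear subspaces of `ℂ^M`. -/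
theorem gabor_distinct_codewords_distinct_subspaces (M n : ℕ)
    (hM : Nat.Prime M) (hM5 : 5 ≤ M) (hn1 : 1 ≤ n) (hn2 : n ≤ M / 2)
    (S₁ S₂ : Finset (Fin M × Fin M))
    (hcard₁ : S₁.card = n) (hcard₂ : S₂.card = n)
    (hinj₁ : ∀ p ∈ S₁, ∀ q ∈ S₁, p.1 = q.1 → p = q)
    (hinj₂ : ∀ p ∈ S₂, ∀ q ∈ S₂, p.1 = q.1 → p = q)
    (hne : S₁ ≠ S₂) :
    Submodule.span ℂ ((fun p : Fin M × Fin M => gabor M p.1 p.2) '' ↑S₁) ≠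
    Submodule.span ℂ ((fun p : Fin M × Fin M => gabor M p.1 p.2) '' ↑S₂) := by
  intro hspan
  obtain ⟨p₀, hp₁, hp₂⟩ : ∃ p ∈ S₁, p ∉ S₂ := Finset.not_subset.mp fun hsub =>
    hne (Finset.eq_of_subset_of_card_le hsub (hcard₂.trans hcard₁.symm).le)
  refine (linearIndepOn_gabor_insert M hM hM5 S₂ (hcard₂.trans_le hn2) hinj₂ p₀
    hp₂).notMem_span_of_insert (by simpa using hp₂) ?_
  rw [← hspan]
  exact Submodule.subset_span ⟨p₀, hp₁, rfl⟩
end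

section
/- Let M ≥ 5 be prime. Let S₁ and S₂ be two distinct subsets of {0,…,M−1} × {0,…,M−1}, each of cardinality at most ⌊M/2⌋ and at least 1, such that within each set the first coordinates (the shift indices k) are pairwise distinct (the cardinalities of S₁ and S₂ need not be equal). Then span{g_{k,l} : (k,l) ∈ S₁} ≠ span{g_{k,l} : (k,l) ∈ S₂} as linear subspaces of ℂ^M. Hence the subspaces arising from all effective codewords of the random-access scheme with at most ⌊M/2⌋ active users are pairwise distinct. -/
open scoped BigOperators

section ChirpIndependence

open Polynomial

theorem map_fwdDiff_iter {A B : Type*} [AddCommGroup A] [AddCommGroup B] (φ : A →+ B)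
    (F : ℕ → A) (n : ℕ) :
    φ ((fwdDiff 1)^[n] F 0) = (fwdDiff 1)^[n] (fun m => φ (F m)) 0 := by
  simp [fwdDiff_iter_eq_sum_shift, map_sum, map_zsmul]

/-- The top finite difference of an integer polynomial along the natural numbers. -/
theorem fwdDiff_iter_eval_natCast {P : ℤ[X]} {n : ℕ} (hP : P.natDegree ≤ n) :
    (fwdDiff 1)^[n] (fun m : ℕ => P.eval (m : ℤ)) 0 = P.coeff n * (n.factorial : ℤ) := by
  have hcast : (fwdDiff 1)^[n] (fun m : ℕ => P.eval (m : ℤ)) 0 = (fwdDiff 1)^[n] P.eval 0 := by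
    simp [fwdDiff_iter_eq_sum_shift]
  rw [hcast]
  rcases hP.lt_or_eq with h | rfl
  · rw [Polynomial.fwdDiff_iter_eq_zero_of_degree_lt h, coeff_eq_zero_of_natDegree_lt h]
    simp
  · rw [Polynomial.fwdDiff_iter_degree_eq_factorial]
    simp

/-- The quadratic exponent of a chirp. -/
def chirpExp (a b m : ℕ) : ℕ := a * m ^ 2 + b * m

theorem descPochhammer_comp_quadratic (a b j : ℕ) :
    ((descPochhammer ℤ j).comp (C (a : ℤ) * X ^ 2 + C (b : ℤ) * X)).natDegree ≤ 2 * j ∧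
    ((descPochhammer ℤ j).comp (C (a : ℤ) * X ^ 2 + C (b : ℤ) * X)).coeff (2 * j) =
      (a : ℤ) ^ j := by
  induction j with
  | zero => simp
  | succ j ih =>
    have hq : (C (a : ℤ) * X ^ 2 + C (b : ℤ) * X - (j : ℤ[X])).natDegree ≤ 2 := by
      compute_degree
    have hq2 : (C (a : ℤ) * X ^ 2 + C (b : ℤ) * X - (j : ℤ[X])).coeff 2 = (a : ℤ) := by
      compute_degree!
    have hmul : (descPochhammer ℤ (j + 1)).comp (C (a : ℤ) * X ^ 2 + C (b : ℤ) * X) =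
        (descPochhammer ℤ j).comp (C (a : ℤ) * X ^ 2 + C (b : ℤ) * X) *
          (C (a : ℤ) * X ^ 2 + C (b : ℤ) * X - (j : ℤ[X])) := by
      rw [descPochhammer_succ_right]
      simp
    rw [hmul, show 2 * (j + 1) = 2 * j + 2 by ring]
    refine ⟨natDegree_mul_le_of_le ih.1 hq, ?_⟩
    rw [coeff_mul_add_eq_of_natDegree_le ih.1 hq, ih.2, hq2, pow_succ]

theorem factorial_mul_choose_chirpExp (a b j m : ℕ) :
    (j.factorial : ℤ) * ((chirpExp a b m).choose j : ℤ) =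
      ((descPochhammer ℤ j).comp (C (a : ℤ) * X ^ 2 + C (b : ℤ) * X)).eval (m : ℤ) := by
  have h : (C (a : ℤ) * X ^ 2 + C (b : ℤ) * X).eval (m : ℤ) = ((chirpExp a b m : ℕ) : ℤ) := by
    simp [chirpExp]
  rw [eval_comp, h, descPochhammer_eval_eq_descFactorial, Nat.descFactorial_eq_factorial_mul_choose]
  push_cast
  rfl

theorem factorial_mul_fwdDiff_choose_chirpExp (a b j n : ℕ) (hn : 2 * j ≤ n) :
    (j.factorial : ℤ) * (fwdDiff 1)^[n] (fun m => ((chirpExp a b m).choose j : ℤ)) 0 =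
      ((descPochhammer ℤ j).comp (C (a : ℤ) * X ^ 2 + C (b : ℤ) * X)).coeff n *
        (n.factorial : ℤ) := by
  rw [← fwdDiff_iter_eval_natCast ((descPochhammer_comp_quadratic a b j).1.trans hn)]
  simp_rw [← factorial_mul_choose_chirpExp]
  exact map_fwdDiff_iter (AddMonoidHom.mulLeft (j.factorial : ℤ)) _ n

theorem fwdDiff_choose_chirpExp_eq_zero {a b j n : ℕ} (hn : 2 * j < n) :
    (fwdDiff 1)^[n] (fun m => ((chirpExp a b m).choose j : ℤ)) 0 = 0 := by
  have h := factorial_mul_fwdDiff_choose_chirpExp a b j n hn.le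
  rw [coeff_eq_zero_of_natDegree_lt ((descPochhammer_comp_quadratic a b j).1.trans_lt hn),
    zero_mul] at h
  exact (mul_eq_zero.mp h).resolve_left (by exact_mod_cast j.factorial_ne_zero)

theorem factorial_mul_fwdDiff_choose_chirpExp_top (a b j : ℕ) :
    (j.factorial : ℤ) * (fwdDiff 1)^[2 * j] (fun m => ((chirpExp a b m).choose j : ℤ)) 0 =
      (a : ℤ) ^ j * ((2 * j).factorial : ℤ) := by
  rw [factorial_mul_fwdDiff_choose_chirpExp a b j _ le_rfl,
    (descPochhammer_comp_quadratic a b j).2]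

/-- The finite differences of a chirp, as polynomials in `X = ω - 1`, are divisible by the power
of `X` forced by the degree of the exponent. -/
theorem exists_fwdDiff_chirp_eq (a b n : ℕ) :
    ∃ Q : ℤ[X], (fwdDiff 1)^[n] (fun m => (1 + X : ℤ[X]) ^ chirpExp a b m) 0 =
        X ^ ((n + 1) / 2) * Q ∧
      Q.coeff 0 =
        (fwdDiff 1)^[n] (fun m => ((chirpExp a b m).choose ((n + 1) / 2) : ℤ)) 0 := by
  have hcoeff (j : ℕ) :
      ((fwdDiff 1)^[n] (fun m => (1 + X : ℤ[X]) ^ chirpExp a b m) 0).coeff j =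
        (fwdDiff 1)^[n] (fun m => ((chirpExp a b m).choose j : ℤ)) 0 := by
    have h := map_fwdDiff_iter (lcoeff ℤ j).toAddMonoidHom
      (fun m => (1 + X : ℤ[X]) ^ chirpExp a b m) n
    simpa [coeff_one_add_X_pow] using h
  obtain ⟨Q, hQ⟩ := X_pow_dvd_iff.mpr fun j (hj : j < (n + 1) / 2) =>
    (hcoeff j).trans (fwdDiff_choose_chirpExp_eq_zero (by omega))
  refine ⟨Q, hQ, ?_⟩
  rw [← hcoeff, hQ]
  simpa using (coeff_X_pow_mul Q ((n + 1) / 2) 0).symm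

theorem aeval_primitiveRoot_sub_one_ne_zero {p : ℕ} [Fact p.Prime] {ω : ℂ}
    (hω : IsPrimitiveRoot ω p) {D : ℤ[X]} (hD : ((D.eval 0 : ℤ) : ZMod p) ≠ 0) :
    aeval (ω - 1) D ≠ 0 := by
  intro h
  have hroot : aeval ω (D.comp (X - 1)) = 0 := by
    simpa [aeval_comp] using h
  have hdvd : cyclotomic p ℤ ∣ D.comp (X - 1) := by
    rw [cyclotomic_eq_minpoly hω (Fact.out : p.Prime).pos]
    exact minpoly.isIntegrallyClosed_dvd (hω.isIntegral (Fact.out : p.Prime).pos) hroot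
  have heval := eval_dvd (x := (1 : ℤ)) hdvd
  rw [eval_one_cyclotomic_prime, eval_comp] at heval
  exact hD ((ZMod.intCast_zmod_eq_zero_iff_dvd _ _).mpr (by simpa using heval))

/-- Chirps are linearly independent as soon as a square system of leading coefficients of their
finite differences is nonsingular modulo `p`. -/
theorem chirp_coeff_eq_zero {p : ℕ} [Fact p.Prime] {ω : ℂ} (hω : IsPrimitiveRoot ω p) {N : ℕ}
    (a b n : Fin N → ℕ) (hn : ∀ r, n r < p)
    (hker : ∀ v : Fin N → ZMod p, (∀ r, ∑ i, (((fwdDiff 1)^[n r]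
      (fun m => ((chirpExp (a i) (b i) m).choose ((n r + 1) / 2) : ℤ)) 0 : ℤ) : ZMod p) * v i = 0) →
      v = 0)
    {c : Fin N → ℂ} (hc : ∀ m < p, ∑ i, c i * ω ^ chirpExp (a i) (b i) m = 0) : c = 0 := by
  choose Q hQ hQ0 using fun r i => exists_fwdDiff_chirp_eq (a i) (b i) (n r)
  have hdet : aeval (ω - 1) (Matrix.of Q).det ≠ 0 := by
    apply aeval_primitiveRoot_sub_one_ne_zero hω
    intro h0
    have hmap : ((Matrix.of Q).map ((Int.castRingHom (ZMod p)).comp (evalRingHom 0))).det = 0 := by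
      rw [← RingHom.mapMatrix_apply, ← RingHom.map_det]
      simpa using h0
    obtain ⟨v, hv, hv0⟩ := Matrix.exists_mulVec_eq_zero_iff.mpr hmap
    refine hv (hker v fun r => ?_)
    have := congrFun hv0 r
    simpa [Matrix.mulVec, dotProduct, ← coeff_zero_eq_eval_zero, hQ0] using this
  have hdet' : ((Matrix.of Q).map (aeval (ω - 1) : ℤ[X] →ₐ[ℤ] ℂ)).det ≠ 0 := by
    rw [← AlgHom.mapMatrix_apply, ← AlgHom.map_det]
    exact hdet
  have hω1 : ω - 1 ≠ 0 := sub_ne_zero.mpr (hω.ne_one (Fact.out : p.Prime).one_lt)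
  refine Matrix.eq_zero_of_mulVec_eq_zero hdet' (funext fun r => ?_)
  refine (mul_eq_zero.mp ?_).resolve_left (pow_ne_zero ((n r + 1) / 2) hω1)
  have hL (i : Fin N) : (ω - 1) ^ ((n r + 1) / 2) * aeval (ω - 1) (Q r i) =
      (fwdDiff 1)^[n r] (fun m => ω ^ chirpExp (a i) (b i) m) 0 := by
    have h := congrArg (aeval (ω - 1)) (hQ r i)
    have h' := map_fwdDiff_iter (aeval (ω - 1) : ℤ[X] →ₐ[ℤ] ℂ).toAddMonoidHom
      (fun m => (1 + X : ℤ[X]) ^ chirpExp (a i) (b i) m) (n r)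
    simp only [map_mul, map_pow, aeval_X] at h
    rw [← h]
    simpa using h'
  simp only [Matrix.mulVec, dotProduct, Matrix.map_apply, Matrix.of_apply, Finset.mul_sum,
    ← mul_assoc, hL]
  simp only [fwdDiff_iter_eq_sum_shift, Finset.sum_mul]
  rw [Finset.sum_comm]
  refine Finset.sum_eq_zero fun m hm => ?_
  have hmp : m < p := by have := hn r; have := Finset.mem_range.mp hm; omega
  calc _ = (((-1 : ℤ) ^ (n r - m) * (n r).choose m : ℤ) : ℂ) *
        ∑ i, c i * ω ^ chirpExp (a i) (b i) m := by
        rw [Finset.mul_sum]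
        refine Finset.sum_congr rfl fun i _ => ?_
        simp only [zsmul_eq_mul, zero_add, smul_eq_mul, mul_one]
        ring
    _ = 0 := by rw [hc m hmp, mul_zero]

/-- The even finite differences of chirps determine the power sums of their curvatures. -/
theorem sum_pow_mul_eq_zero_of_fwdDiff {p : ℕ} [Fact p.Prime] {N j : ℕ} (hj : 2 * j < p)
    {a b : Fin N → ℕ} {v : Fin N → ZMod p}
    (h : ∑ i, (((fwdDiff 1)^[2 * j]
      (fun m => ((chirpExp (a i) (b i) m).choose j : ℤ)) 0 : ℤ) : ZMod p) * v i = 0) :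
    ∑ i, v i * (a i : ZMod p) ^ j = 0 := by
  have hfac : ((2 * j).factorial : ZMod p) ≠ 0 := by
    rw [Ne, ZMod.natCast_eq_zero_iff, (Fact.out : p.Prime).dvd_factorial]
    omega
  refine (mul_eq_zero.mp ?_).resolve_left hfac
  rw [← mul_zero (j.factorial : ZMod p), ← h, Finset.mul_sum, Finset.mul_sum]
  refine Finset.sum_congr rfl fun i _ => ?_
  have htop := congrArg (Int.cast : ℤ → ZMod p)
    (factorial_mul_fwdDiff_choose_chirpExp_top (a i) (b i) j)
  push_cast at htop
  linear_combination -(v i) * htop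

theorem chirp_coeff_eq_zero_of_injective {p : ℕ} [Fact p.Prime] {ω : ℂ}
    (hω : IsPrimitiveRoot ω p) {N : ℕ} (hN : 2 * N ≤ p + 1) {a b : Fin N → ℕ}
    (ha : Function.Injective fun i => (a i : ZMod p))
    {c : Fin N → ℂ} (hc : ∀ m < p, ∑ i, c i * ω ^ chirpExp (a i) (b i) m = 0) : c = 0 := by
  refine chirp_coeff_eq_zero hω a b (fun r => 2 * (r : ℕ)) (fun r => by omega) (fun v hv => ?_) hc
  refine Matrix.eq_zero_of_forall_pow_sum_mul_pow_eq_zero ha fun r => ?_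
  refine sum_pow_mul_eq_zero_of_fwdDiff (b := b) (by omega) ?_
  have := hv r
  rwa [show (2 * (r : ℕ) + 1) / 2 = r by omega] at this

/-- One of the curvatures may be repeated once, provided the corresponding slopes differ. -/
theorem chirp_coeff_eq_zero_of_repeated {p : ℕ} [Fact p.Prime] {ω : ℂ}
    (hω : IsPrimitiveRoot ω p) {N : ℕ} (hN : 2 * N ≤ p) {a b : Fin (N + 1) → ℕ}
    (ha : Function.Injective fun i : Fin N => (a i.succ : ZMod p)) {s : Fin N}
    (has : (a 0 : ZMod p) = a s.succ) (hbs : (b 0 : ZMod p) ≠ b s.succ)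
    {c : Fin (N + 1) → ℂ} (hc : ∀ m < p, ∑ i, c i * ω ^ chirpExp (a i) (b i) m = 0) : c = 0 := by
  have hp := (Fact.out : p.Prime).one_lt
  refine chirp_coeff_eq_zero hω a b (Fin.cons 1 fun r : Fin N => 2 * (r : ℕ))
    (Fin.cases (by simpa using hp) fun r => by simp only [Fin.cons_succ]; omega)
    (fun v hv => ?_) hc
  have hsum : (fun i : Fin N => v i.succ + if i = s then v 0 else 0) = 0 := by
    refine Matrix.eq_zero_of_forall_pow_sum_mul_pow_eq_zero ha fun r => ?_
    have hr := hv r.succ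
    simp only [Fin.cons_succ, show (2 * (r : ℕ) + 1) / 2 = r by omega] at hr
    have := sum_pow_mul_eq_zero_of_fwdDiff (by omega) hr
    rw [Fin.sum_univ_succ, has] at this
    simp only [add_mul, Finset.sum_add_distrib, ite_mul, zero_mul, Finset.sum_ite_eq',
      Finset.mem_univ, if_true]
    rw [add_comm]
    exact this
  have hsucc (i : Fin N) : v i.succ = -if i = s then v 0 else 0 :=
    eq_neg_of_add_eq_zero_left (congrFun hsum i)
  have h0 : v 0 = 0 := by
    have h := hv 0
    simp only [Fin.cons_zero, Fin.sum_univ_succ, hsucc] at h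
    simp [fwdDiff, chirpExp, has] at h
    refine (mul_eq_zero.mp ?_).resolve_left (sub_ne_zero.mpr hbs)
    linear_combination h
  funext i
  refine Fin.cases h0 (fun i => ?_) i
  simp [hsucc, h0]

/-- The curvature of the chirp underlying a Gabor vector. -/
def gaborCurvature {M : ℕ} (p : Fin M × Fin M) : ℕ := 3 * (M - p.1)

/-- The slope of the chirp underlying a Gabor vector. -/
def gaborSlope {M : ℕ} (p : Fin M × Fin M) : ℕ := 3 * (p.1 : ℕ) ^ 2 + p.2

theorem gabor_mul_eq_chirp {M : ℕ} (p : Fin M × Fin M) (m : Fin M) :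
    gabor M p.1 p.2 m * Complex.exp (2 * Real.pi * Complex.I / M) ^ ((p.1 : ℕ) ^ 3) =
      Complex.exp (2 * Real.pi * Complex.I / M) ^ ((m : ℕ) ^ 3) *
        Complex.exp (2 * Real.pi * Complex.I / M) ^
          chirpExp (gaborCurvature p) (gaborSlope p) m := by
  have hM : (M : ℂ) ≠ 0 := by
    have := m.pos
    exact_mod_cast this.ne'
  rw [gabor, ← Complex.exp_nat_mul, ← Complex.exp_nat_mul, ← Complex.exp_nat_mul,
    ← Complex.exp_add, ← Complex.exp_add, Complex.exp_eq_exp_iff_exists_int]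
  refine ⟨-(3 * (m : ℤ) ^ 2), ?_⟩
  simp only [chirpExp, gaborCurvature, gaborSlope]
  push_cast [p.1.isLt.le]
  field_simp
  ring

theorem linearIndependent_gabor {M N : ℕ} [NeZero M] (q : Fin N → Fin M × Fin M)
    (h : ∀ c : Fin N → ℂ, (∀ m < M, ∑ i, c i * Complex.exp (2 * Real.pi * Complex.I / M) ^
      chirpExp (gaborCurvature (q i)) (gaborSlope (q i)) m = 0) → c = 0) :
    LinearIndependent ℂ fun i => gabor M (q i).1 (q i).2 := by
  set ω := Complex.exp (2 * Real.pi * Complex.I / M) with hωdef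
  have hω : ω ≠ 0 := Complex.exp_ne_zero _
  rw [Fintype.linearIndependent_iff]
  intro c hc i
  have hz := h (fun i => c i * (ω ^ (((q i).1 : ℕ) ^ 3))⁻¹) fun m hm => by
    refine (mul_eq_zero.mp ?_).resolve_left (pow_ne_zero (m ^ 3) hω)
    have hcm := congrFun hc ⟨m, hm⟩
    simp only [Finset.sum_apply, Pi.smul_apply, smul_eq_mul, Pi.zero_apply] at hcm
    rw [← hcm, Finset.mul_sum]
    refine Finset.sum_congr rfl fun i _ => ?_
    have hg := gabor_mul_eq_chirp (q i) ⟨m, hm⟩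
    rw [← hωdef] at hg
    have hne := pow_ne_zero (((q i).1 : ℕ) ^ 3) hω
    field_simp
    linear_combination -(c i) * hg
  exact (mul_eq_zero.mp (congrFun hz i)).resolve_right (inv_ne_zero (pow_ne_zero _ hω))

theorem fin_ext_of_natCast_eq {M : ℕ} {x y : Fin M}
    (h : ((x : ℕ) : ZMod M) = ((y : ℕ) : ZMod M)) : x = y := by
  rw [ZMod.natCast_eq_natCast_iff] at h
  exact Fin.ext (h.eq_of_lt_of_lt x.isLt y.isLt)

theorem fst_eq_of_gaborCurvature_eq {M : ℕ} [Fact M.Prime] (hM5 : 5 ≤ M) {p q : Fin M × Fin M}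
    (h : (gaborCurvature p : ZMod M) = gaborCurvature q) : p.1 = q.1 := by
  have h3 : (3 : ZMod M) ≠ 0 := by
    intro h
    have h' : ((3 : ℕ) : ZMod M) = 0 := by exact_mod_cast h
    rw [ZMod.natCast_eq_zero_iff] at h'
    have := Nat.le_of_dvd (by norm_num) h'
    omega
  rw [gaborCurvature, gaborCurvature] at h
  push_cast [p.1.isLt.le, q.1.isLt.le] at h
  have := mul_left_cancel₀ h3 h
  exact fin_ext_of_natCast_eq (by simpa using this)

theorem gabor_notMem_span {M : ℕ} (hM : M.Prime) (hM5 : 5 ≤ M) {S : Finset (Fin M × Fin M)}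
    (hcard : S.card ≤ M / 2) (hinj : ∀ p ∈ S, ∀ q ∈ S, p.1 = q.1 → p = q)
    {p : Fin M × Fin M} (hp : p ∉ S) :
    gabor M p.1 p.2 ∉
      Submodule.span ℂ ((fun p : Fin M × Fin M => gabor M p.1 p.2) '' ↑S) := by
  have : Fact M.Prime := ⟨hM⟩
  have : NeZero M := ⟨hM.ne_zero⟩
  have hω := Complex.isPrimitiveRoot_exp M hM.ne_zero
  let e := S.equivFin.symm
  let q : Fin (S.card + 1) → Fin M × Fin M := Fin.cons p fun i => (e i : Fin M × Fin M)
  have hq0 : q 0 = p := rfl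
  have hinj' : Function.Injective fun i : Fin S.card => (gaborCurvature (q i.succ) : ZMod M) := by
    intro i j hij
    have := hinj _ (e i).2 _ (e j).2 (fst_eq_of_gaborCurvature_eq hM5 hij)
    exact e.injective (Subtype.ext this)
  have hli : LinearIndependent ℂ fun i => gabor M (q i).1 (q i).2 := by
    refine linearIndependent_gabor q fun c hc => ?_
    by_cases hdup : ∃ s : Fin S.card, p.1 = (q s.succ).1
    · obtain ⟨s, hs⟩ := hdup
      refine chirp_coeff_eq_zero_of_repeated hω (by omega) hinj' (s := s) ?_ ?_ hc
      · simp only [gaborCurvature, hq0, hs]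
      · intro hb
        simp only [gaborSlope, hq0, hs] at hb
        push_cast at hb
        have h2 := fin_ext_of_natCast_eq (add_left_cancel hb)
        have hpe : p = e s := Prod.ext hs h2
        exact hp (hpe ▸ (e s).2)
    · have hodd := hM.eq_two_or_odd
      refine chirp_coeff_eq_zero_of_injective hω (by omega) ?_ hc
      intro i j
      induction i using Fin.cases with
      | zero =>
        induction j using Fin.cases with
        | zero => simp
        | succ j => exact fun h => (hdup ⟨j, fst_eq_of_gaborCurvature_eq hM5 h⟩).elim
      | succ i =>
        induction j using Fin.cases with
        | zero => exact fun h => (hdup ⟨i, fst_eq_of_gaborCurvature_eq hM5 h.symm⟩).elim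
        | succ j => exact fun h => congrArg Fin.succ (hinj' h)
  have hcons : (fun i => gabor M (q i).1 (q i).2) =
      Fin.cons (gabor M p.1 p.2) fun i => gabor M (e i : Fin M × Fin M).1 (e i).1.2 := by
    funext i
    refine Fin.cases rfl (fun i => rfl) i
  rw [hcons, linearIndependent_finCons] at hli
  have hrange : (fun p : Fin M × Fin M => gabor M p.1 p.2) '' ↑S =
      Set.range fun i => gabor M (e i : Fin M × Fin M).1 (e i).1.2 := by
    ext x
    constructor
    · rintro ⟨y, hy, rfl⟩
      exact ⟨e.symm ⟨y, hy⟩, by simp⟩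
    · rintro ⟨i, rfl⟩
      exact ⟨e i, (e i).2, rfl⟩
  rw [hrange]
  exact hli.2

theorem subset_of_gabor_span_le {M : ℕ} (hM : M.Prime) (hM5 : 5 ≤ M)
    {S T : Finset (Fin M × Fin M)} (hcard : T.card ≤ M / 2)
    (hinj : ∀ p ∈ T, ∀ q ∈ T, p.1 = q.1 → p = q)
    (hle : Submodule.span ℂ ((fun p : Fin M × Fin M => gabor M p.1 p.2) '' ↑S) ≤
      Submodule.span ℂ ((fun p : Fin M × Fin M => gabor M p.1 p.2) '' ↑T)) : S ⊆ T := by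
  intro p hp
  by_contra hpT
  exact gabor_notMem_span hM hM5 hcard hinj hpT
    (hle (Submodule.subset_span ⟨p, hp, rfl⟩))

end ChirpIndependence

/-- For a prime `M ≥ 5`, two distinct effective codewords of possibly different sizes,
each consisting of between `1` and `⌊M/2⌋` index pairs with pairwise distinct shift
indices, span distinct linear subspaces of `ℂ^M`. -/
theorem gabor_distinct_codewords_distinct_subspaces_general (M : ℕ)
    (hM : Nat.Prime M) (hM5 : 5 ≤ M)
    (S₁ S₂ : Finset (Fin M × Fin M))
    (hcard₁ : 1 ≤ S₁.card) (hcard₁' : S₁.card ≤ M / 2)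
    (hcard₂ : 1 ≤ S₂.card) (hcard₂' : S₂.card ≤ M / 2)
    (hinj₁ : ∀ p ∈ S₁, ∀ q ∈ S₁, p.1 = q.1 → p = q)
    (hinj₂ : ∀ p ∈ S₂, ∀ q ∈ S₂, p.1 = q.1 → p = q)
    (hne : S₁ ≠ S₂) :
    Submodule.span ℂ ((fun p : Fin M × Fin M => gabor M p.1 p.2) '' ↑S₁) ≠
    Submodule.span ℂ ((fun p : Fin M × Fin M => gabor M p.1 p.2) '' ↑S₂) := by
  intro h
  exact hne ((subset_of_gabor_span_le hM hM5 hcard₂' hinj₂ h.le).antisymm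
    (subset_of_gabor_span_le hM hM5 hcard₁' hinj₁ h.ge))
end
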